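/- arXiv:math/9805065 — 2 statements merged into one kernel-verified Lean document; each statement's English description precedes it below -/
import Mathlib

section
/- Let n ≥ 2 and N ≥ 1, let U ⊆ ℝⁿ be open and connected. Let A₁,…,A_n : U → Matrix (Fin N) (Fin N) ℝ and B : U → Matrix (Fin N) (Fin N) ℝ be smooth with ∑ⱼ ξⱼ Aⱼ(x) invertible for all x ∈ U and ξ ∈ ℝⁿ \ {0}, and assume the linear operator Dψ = ∑ⱼ Aⱼ(x)(∂ψ/∂xⱼ) + B(x)ψ has the strong unique continuation property. Let A ⊆ U be closed in U with Hausdorff dimension dimH(A) > n − 2. If φ₁, φ₂ : U → ℝ^N are smooth solutions of Dφᵢ = 0 and φ₁(x) = φ₂(x) for all x ∈ A, then φ₁ = φ₂ on all of U. -/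
open MeasureTheory Metric Set Filter Topology ENNReal NNReal

noncomputable section

/-- `m`-dimensional Euclidean space. -/
abbrev Euc (m : ℕ) := EuclideanSpace ℝ (Fin m)

/-- The semilinear first-order differential operator `φ ↦ ∑ⱼ Aⱼ(x) ∂φ/∂xⱼ + V(x, φ(x))`
applied to `φ` at the point `x`. -/
def semilinApply {n N : ℕ} (A : Fin n → Euc n → Matrix (Fin N) (Fin N) ℝ)
    (V : Euc n → (Fin N → ℝ) → (Fin N → ℝ)) (φ : Euc n → (Fin N → ℝ)) (x : Euc n) :
    Fin N → ℝ :=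
  (∑ j, (A j x).mulVec (fderiv ℝ φ x (EuclideanSpace.single j 1))) + V x (φ x)

/-- Ellipticity of the principal symbol `ξ ↦ ∑ⱼ ξⱼ Aⱼ(x)` at every point of `U`. -/
def IsElliptic {n N : ℕ} (A : Fin n → Euc n → Matrix (Fin N) (Fin N) ℝ)
    (U : Set (Euc n)) : Prop :=
  ∀ x ∈ U, ∀ ξ : Euc n, ξ ≠ 0 → IsUnit (∑ j, ξ j • A j x)

/-- A set `S ⊆ ℝⁿ` is countably `m`-`C^∞`-rectifiable if it is contained in a countable
union of ranges of smooth maps `ℝᵐ → ℝⁿ`. -/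
def CountablyCinfRectifiable {n : ℕ} (m : ℕ) (S : Set (Euc n)) : Prop :=
  ∃ g : ℕ → (Euc m → Euc n), (∀ i, ContDiff ℝ (⊤ : ℕ∞) (g i)) ∧ S ⊆ ⋃ i, range (g i)

/-- The linear first-order differential operator `ψ ↦ ∑ⱼ Aⱼ(x) ∂ψ/∂xⱼ + B(x)ψ`
applied to `ψ` at the point `x`. -/
def linApply {n N : ℕ} (A : Fin n → Euc n → Matrix (Fin N) (Fin N) ℝ)
    (B : Euc n → Matrix (Fin N) (Fin N) ℝ) (ψ : Euc n → (Fin N → ℝ)) (x : Euc n) :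
    Fin N → ℝ :=
  (∑ j, (A j x).mulVec (fderiv ℝ ψ x (EuclideanSpace.single j 1))) + (B x).mulVec (ψ x)

/-- The strong unique continuation property for the linear operator on `U`. -/
def HasSUCPlin {n N : ℕ} (A : Fin n → Euc n → Matrix (Fin N) (Fin N) ℝ)
    (B : Euc n → Matrix (Fin N) (Fin N) ℝ) (U : Set (Euc n)) : Prop :=
  ∀ W ⊆ U, IsOpen W → IsConnected W → ∀ ψ : Euc n → (Fin N → ℝ),
    ContDiffOn ℝ (⊤ : ℕ∞) ψ W → (∀ x ∈ W, linApply A B ψ x = 0) →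
    (∃ p ∈ W, ∀ k, iteratedFDeriv ℝ k ψ p = 0) → ∀ x ∈ W, ψ x = 0

section
variable {E F : Type*} [NormedAddCommGroup E] [NormedSpace ℝ E] [NormedAddCommGroup F]
  [NormedSpace ℝ F]

theorem iteratedFDeriv_fderiv_apply_eq {f : E → F} {U : Set E} (hU : IsOpen U)
    (hf : ContDiffOn ℝ (⊤ : ℕ∞) f U) (v : E) (m : ℕ) :
    ∀ x ∈ U, ∀ w : Fin m → E,
      iteratedFDeriv ℝ m (fun y => fderiv ℝ f y v) x w =
        fderiv ℝ (iteratedFDeriv ℝ m f) x v w := by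
  have hf' : ∀ x ∈ U, ContDiffAt ℝ (⊤ : ℕ∞) f x := fun x hx => hf.contDiffAt (hU.mem_nhds hx)
  have hiter : ∀ x ∈ U, ∀ k : ℕ, ContDiffAt ℝ (⊤ : ℕ∞) (iteratedFDeriv ℝ k f) x :=
    fun x hx k => (hf' x hx).iteratedFDeriv_right (by exact_mod_cast le_top)
  have hdir : ∀ x ∈ U, ContDiffAt ℝ (⊤ : ℕ∞) (fun y => fderiv ℝ f y v) x :=
    fun x hx => ((hf' x hx).fderiv_right (m := (⊤ : ℕ∞)) (by exact_mod_cast le_top)).clm_apply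
      contDiffAt_const
  induction m with
  | zero =>
    intro x hx w
    rw [← fderiv_continuousMultilinear_apply_const_apply
      ((hiter x hx 0).differentiableAt (by simp))]
    simp
  | succ m ih =>
    intro x hx w
    have hG : ContDiffAt ℝ (⊤ : ℕ∞) (fun y => iteratedFDeriv ℝ m f y (Fin.tail w)) x :=
      ((ContinuousMultilinearMap.apply ℝ (fun _ : Fin m => E) F (Fin.tail w)).contDiff.contDiffAt
        ).comp x (hiter x hx m)
    have hdd : DifferentiableAt ℝ
        (fderiv ℝ (fun y => iteratedFDeriv ℝ m f y (Fin.tail w))) x :=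
      (hG.fderiv_right (m := (⊤ : ℕ∞)) (by exact_mod_cast le_top)).differentiableAt (by simp)
    have hsymm : IsSymmSndFDerivAt ℝ (fun y => iteratedFDeriv ℝ m f y (Fin.tail w)) x :=
      hG.isSymmSndFDerivAt (by
        rw [minSmoothness_of_isRCLikeNormedField]
        exact WithTop.coe_le_coe.2 (le_top : (2 : ℕ∞) ≤ ⊤))
    have hleft : ∀ᶠ y in 𝓝 x, iteratedFDeriv ℝ m (fun z => fderiv ℝ f z v) y (Fin.tail w) =
        fderiv ℝ (fun y => iteratedFDeriv ℝ m f y (Fin.tail w)) y v := by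
      filter_upwards [hU.mem_nhds hx] with y hy
      rw [ih y hy, fderiv_continuousMultilinear_apply_const_apply
        ((hiter y hy m).differentiableAt (by simp))]
    have hright : ∀ᶠ y in 𝓝 x, iteratedFDeriv ℝ (m + 1) f y w =
        fderiv ℝ (fun y => iteratedFDeriv ℝ m f y (Fin.tail w)) y (w 0) := by
      filter_upwards [hU.mem_nhds hx] with y hy
      exact ((hiter y hy m).differentiableAt (by simp)).iteratedFDeriv_succ_apply_left'
    rw [DifferentiableAt.iteratedFDeriv_succ_apply_left'
      (((hdir x hx).iteratedFDeriv_right (i := m) (m := (⊤ : ℕ∞))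
        (by exact_mod_cast le_top)).differentiableAt (by simp)),
      ← fderiv_continuousMultilinear_apply_const_apply
        ((hiter x hx (m + 1)).differentiableAt (by simp)),
      Filter.EventuallyEq.fderiv_eq hleft, Filter.EventuallyEq.fderiv_eq hright,
      fderiv_clm_apply hdd (differentiableAt_const _),
      fderiv_clm_apply hdd (differentiableAt_const _)]
    simpa using hsymm (w 0) v

theorem iteratedFDeriv_mul_eq_smul_of_vanishing {a u : E → ℝ} {U : Set E} (hU : IsOpen U)
    (ha : ContDiffOn ℝ (⊤ : ℕ∞) a U) (hu : ContDiffOn ℝ (⊤ : ℕ∞) u U) {p : E} (hp : p ∈ U)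
    {m : ℕ} (h : ∀ i < m, iteratedFDeriv ℝ i u p = 0) :
    iteratedFDeriv ℝ m (fun x => a x * u x) p = a p • iteratedFDeriv ℝ m u p := by
  have hm : ((m : ℕ∞) : WithTop ℕ∞) ≤ ((⊤ : ℕ∞) : WithTop ℕ∞) := by exact_mod_cast le_top
  have hrem : iteratedFDeriv ℝ m (fun x => (a x - a p) * u x) p = 0 := by
    rw [← norm_le_zero_iff, ← iteratedFDerivWithin_of_isOpen m hU hp]
    refine (norm_iteratedFDerivWithin_mul_le (ha.sub contDiffOn_const) hu hU.uniqueDiffOn hp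
      hm).trans (Finset.sum_nonpos fun i _ => ?_)
    rcases Nat.eq_zero_or_pos i with rfl | hi
    · simp
    · rcases Nat.eq_zero_or_pos m with rfl | hm
      · simp_all
      · rw [iteratedFDerivWithin_of_isOpen (m - i) hU hp, h (m - i) (by omega)]
        simp
  have hup : ContDiffAt ℝ m u p := (hu.contDiffAt (hU.mem_nhds hp)).of_le hm
  have hap : ContDiffAt ℝ m a p := (ha.contDiffAt (hU.mem_nhds hp)).of_le hm
  have hsplit : (fun x => a x * u x) = fun x => (a x - a p) * u x + a p • u x := by
    ext x; simp only [smul_eq_mul]; ring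
  rw [hsplit, fun_iteratedFDeriv_add_apply ((hap.sub contDiffAt_const).mul hup)
    (hup.const_smul _), hrem, zero_add, iteratedFDeriv_const_smul_apply' hup]

theorem dimH_le_finrank_ker_of_hasStrictFDerivAt [FiniteDimensional ℝ E] {g : E → F}
    {L : E →L[ℝ] F} {p : E} (hg : HasStrictFDerivAt g L p) {S : Set E}
    (hS : ∀ x ∈ S, g x = 0) :
    ∃ t ∈ 𝓝[S] p, dimH t ≤ Module.finrank ℝ (LinearMap.ker L.toLinearMap) := by
  obtain ⟨π, hπ⟩ := Submodule.ClosedComplemented.of_finiteDimensional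
    (LinearMap.ker L.toLinearMap)
  have hinj : LinearMap.ker (L.prod π).toLinearMap = ⊥ := by
    refine (Submodule.eq_bot_iff _).2 fun x hx => ?_
    obtain ⟨h₁, h₂⟩ : L x = 0 ∧ π x = 0 := by simpa [Prod.ext_iff] using hx
    simpa [h₂] using (congrArg Subtype.val (hπ ⟨x, h₁⟩)).symm
  obtain ⟨K, hK, hanti⟩ := LinearMap.exists_antilipschitzWith _ hinj
  have hε : (0 : ℝ) < 1 / (2 * K) := by positivity
  obtain ⟨V, hVo, hpV, hV⟩ := exists_nhds_square (hg.isLittleO.def hε)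
  refine ⟨S ∩ V, inter_mem_nhdsWithin S (hVo.mem_nhds hpV), ?_⟩
  have hπanti : AntilipschitzWith K (fun x : ↥(S ∩ V) => π x) := by
    refine AntilipschitzWith.of_le_mul_dist fun x y => ?_
    have hLxy : ‖L (x - y : E)‖ ≤ 1 / (2 * K) * ‖(x - y : E)‖ := by
      have : ‖g x - g y - L (x - y : E)‖ ≤ 1 / (2 * K) * ‖(x - y : E)‖ :=
        hV (mk_mem_prod x.2.2 y.2.2)
      rwa [hS _ x.2.1, hS _ y.2.1, sub_zero, zero_sub, norm_neg] at this
    have hmax := hanti.le_mul_dist (x : E) (y : E)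
    simp only [dist_eq_norm, ContinuousLinearMap.coe_coe, ContinuousLinearMap.prod_apply,
      Prod.mk_sub_mk, Prod.norm_mk, ← map_sub] at hmax
    rw [Subtype.dist_eq, dist_eq_norm, dist_eq_norm, ← map_sub]
    rcases max_cases ‖L (x - y : E)‖ ‖π (x - y : E)‖ with ⟨h, -⟩ | ⟨h, -⟩
    · rw [h] at hmax
      have h2 : (K : ℝ) * ‖L (x - y : E)‖ ≤ 1 / 2 * ‖(x - y : E)‖ := by
        calc (K : ℝ) * ‖L (x - y : E)‖ ≤ K * (1 / (2 * K) * ‖(x - y : E)‖) := by gcongr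
          _ = _ := by field_simp
      have h3 : (0 : ℝ) ≤ K * ‖π (x - y : E)‖ := by positivity
      linarith [norm_nonneg (x - y : E)]
    · rwa [h] at hmax
  calc dimH (S ∩ V) = dimH (univ : Set ↥(S ∩ V)) := by
        rw [← (isometry_subtype_coe (s := S ∩ V)).dimH_image, image_univ, Subtype.range_coe]
    _ ≤ dimH ((fun x : ↥(S ∩ V) => π x) '' univ) := hπanti.le_dimH_image _
    _ ≤ dimH (univ : Set (LinearMap.ker L.toLinearMap)) := dimH_mono (subset_univ _)
    _ = _ := Real.dimH_univ_eq_finrank _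

end

theorem exists_forall_smul_eq_of_finrank_lt {K V W : Type*} [Field K] [AddCommGroup V] [Module K V]
    [FiniteDimensional K V] [AddCommGroup W] [Module K W] (L : V →ₗ[K] W)
    (h : Module.finrank K V < Module.finrank K (LinearMap.ker L) + 2) :
    ∃ T : W, ∀ v, ∃ c : K, c • T = L v := by
  have hrank := L.finrank_range_add_finrank_ker
  obtain ⟨T, hT⟩ := finrank_le_one_iff.1
    (show Module.finrank K (LinearMap.range L) ≤ 1 by omega)
  refine ⟨T, fun v => ?_⟩
  obtain ⟨c, hc⟩ := hT ⟨L v, v, rfl⟩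
  exact ⟨c, congrArg Subtype.val hc⟩

theorem finrank_ker_add_two_le_of_elliptic {n N m : ℕ}
    {A : Fin n → Matrix (Fin N) (Fin N) ℝ}
    (hell : ∀ ξ : Euc n, ξ ≠ 0 → IsUnit (∑ j, ξ j • A j))
    {L : Euc n →L[ℝ] (Euc n [×m]→L[ℝ] (Fin N → ℝ))} (hL : L ≠ 0)
    (hAL : ∀ w, ∑ j, (A j).mulVec (L (EuclideanSpace.single j 1) w) = 0) :
    Module.finrank ℝ (LinearMap.ker L.toLinearMap) + 2 ≤ n := by
  by_contra hlt
  obtain ⟨T, hc⟩ := exists_forall_smul_eq_of_finrank_lt L.toLinearMap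
    (by rw [finrank_euclideanSpace_fin]; omega)
  choose c hc using hc
  simp only [ContinuousLinearMap.coe_coe] at hc
  obtain ⟨v, hv⟩ : ∃ v, L v ≠ 0 := by
    by_contra! h
    exact hL (ContinuousLinearMap.ext h)
  obtain ⟨w, hw⟩ : ∃ w, T w ≠ 0 := by
    by_contra! h
    exact hv (by rw [← hc v, ContinuousMultilinearMap.ext (f' := 0) h, smul_zero])
  let ξ : Euc n := WithLp.toLp 2 fun j => c (EuclideanSpace.single j 1)
  have hξ : ξ ≠ 0 := by
    intro h
    refine hL (ContinuousLinearMap.coe_injective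
      ((EuclideanSpace.basisFun (Fin n) ℝ).toBasis.ext fun j => ?_))
    have hj : c (EuclideanSpace.single j 1) = 0 := congrArg (fun η : Euc n => η j) h
    simp [← hc, hj]
  refine hw (Matrix.mulVec_injective_of_isUnit (hell ξ hξ) ?_)
  rw [Matrix.mulVec_zero, Matrix.sum_mulVec, ← hAL w]
  refine Finset.sum_congr rfl fun j _ => ?_
  rw [← hc, _root_.smul_apply, Matrix.mulVec_smul, Matrix.smul_mulVec]

/-- At a point where a solution vanishes to order `m`, the lower-order term of the operator and
the variation of its coefficients do not contribute to the `m`-th derivative of the equation. -/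
theorem sum_mulVec_fderiv_iteratedFDeriv_eq_zero {n N : ℕ} {U : Set (Euc n)} (hU : IsOpen U)
    {A : Fin n → Euc n → Matrix (Fin N) (Fin N) ℝ}
    (hA : ∀ j i l, ContDiffOn ℝ (⊤ : ℕ∞) (fun x => A j x i l) U)
    {B : Euc n → Matrix (Fin N) (Fin N) ℝ}
    (hB : ∀ i l, ContDiffOn ℝ (⊤ : ℕ∞) (fun x => B x i l) U)
    {ψ : Euc n → (Fin N → ℝ)} (hψ : ContDiffOn ℝ (⊤ : ℕ∞) ψ U)
    (heq : ∀ x ∈ U, linApply A B ψ x = 0) {p : Euc n} (hp : p ∈ U) {m : ℕ}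
    (hvan : ∀ i ≤ m, iteratedFDeriv ℝ i ψ p = 0) (w : Fin m → Euc n) :
    ∑ j, (A j p).mulVec
      (fderiv ℝ (iteratedFDeriv ℝ m ψ) p (EuclideanSpace.single j 1) w) = 0 := by
  have htop (k : ℕ) : ((k : ℕ∞) : WithTop ℕ∞) ≤ ((⊤ : ℕ∞) : WithTop ℕ∞) := by
    exact_mod_cast le_top
  have hdir (j : Fin n) : ContDiffOn ℝ (⊤ : ℕ∞)
      (fun x => fderiv ℝ ψ x (EuclideanSpace.single j 1)) U :=
    (hψ.fderiv_of_isOpen hU (m := (⊤ : ℕ∞)) (by exact_mod_cast le_top)).clm_apply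
      contDiffOn_const
  have hcomp {k : ℕ} {f : Euc n → (Fin N → ℝ)} (hf : ContDiffOn ℝ (⊤ : ℕ∞) f U) (l : Fin N)
      (u : Fin k → Euc n) :
      iteratedFDeriv ℝ k (fun x => f x l) p u = iteratedFDeriv ℝ k f p u l := by
    have := (ContinuousLinearMap.proj (R := ℝ) (φ := fun _ : Fin N => ℝ) l).iteratedFDeriv_comp_left
      (hf.contDiffAt (hU.mem_nhds hp)) (htop k)
    exact congrArg (fun T => T u) this
  have hdirvan (j : Fin n) : ∀ i < m, iteratedFDeriv ℝ i
      (fun x => fderiv ℝ ψ x (EuclideanSpace.single j 1)) p = 0 := fun i hi => by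
    ext1 u
    rw [iteratedFDeriv_fderiv_apply_eq hU hψ _ i p hp]
    have h := iteratedFDeriv_succ_apply_left (𝕜 := ℝ) (f := ψ) (x := p)
      (Fin.cons (EuclideanSpace.single j 1) u : Fin (i + 1) → Euc n)
    rw [hvan (i + 1) hi] at h
    simpa using h.symm
  ext i
  have hzero : iteratedFDeriv ℝ m (fun x =>
      (∑ j, ∑ l, A j x i l * fderiv ℝ ψ x (EuclideanSpace.single j 1) l) +
        ∑ l, B x i l * ψ x l) p = 0 := by
    rw [← iteratedFDerivWithin_of_isOpen m hU hp,
      iteratedFDerivWithin_congr (f := fun _ => (0 : ℝ)) (fun x hx => ?_) hp]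
    · simp
    · simpa [linApply, Matrix.mulVec, dotProduct] using congrFun (heq x hx) i
  have hat {f : Euc n → ℝ} (hf : ContDiffOn ℝ (⊤ : ℕ∞) f U) : ContDiffAt ℝ m f p :=
    (hf.contDiffAt (hU.mem_nhds hp)).of_le (htop m)
  have hAj (j : Fin n) (l : Fin N) := (hA j i l).mul ((contDiffOn_pi.1 (hdir j)) l)
  have hBl (l : Fin N) := (hB i l).mul ((contDiffOn_pi.1 hψ) l)
  rw [fun_iteratedFDeriv_add_apply
      (hat (ContDiffOn.sum fun j _ => ContDiffOn.sum fun l _ => hAj j l))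
      (hat (ContDiffOn.sum fun l _ => hBl l)),
    iteratedFDeriv_fun_sum_apply fun j _ => hat (ContDiffOn.sum fun l _ => hAj j l),
    iteratedFDeriv_fun_sum_apply fun l _ => hat (hBl l)] at hzero
  have hBzero (l : Fin N) : iteratedFDeriv ℝ m (fun x => B x i l * ψ x l) p = 0 := by
    have hl (k : ℕ) (hk : k ≤ m) : iteratedFDeriv ℝ k (fun x => ψ x l) p = 0 := by
      ext u
      simp [hcomp hψ, hvan k hk]
    rw [iteratedFDeriv_mul_eq_smul_of_vanishing hU (hB i l) (contDiffOn_pi.1 hψ l) hp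
      fun k hk => hl k hk.le, hl m le_rfl, smul_zero]
  have hAterm (j : Fin n) : iteratedFDeriv ℝ m
      (fun x => ∑ l, A j x i l * fderiv ℝ ψ x (EuclideanSpace.single j 1) l) p w =
      (A j p).mulVec (fderiv ℝ (iteratedFDeriv ℝ m ψ) p (EuclideanSpace.single j 1) w) i := by
    rw [iteratedFDeriv_fun_sum_apply fun l _ => hat (hAj j l), _root_.sum_apply]
    refine Finset.sum_congr rfl fun l _ => ?_
    rw [iteratedFDeriv_mul_eq_smul_of_vanishing hU (hA j i l) (contDiffOn_pi.1 (hdir j) l) hp,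
      _root_.smul_apply, hcomp (hdir j),
      iteratedFDeriv_fderiv_apply_eq hU hψ _ m p hp, smul_eq_mul]
    intro k hk
    ext u
    simp [hcomp (hdir j), hdirvan j k hk]
  have := congrArg (fun T => T w) hzero
  simpa [hBzero, hAterm] using this

/-- The set where a solution vanishes to finite order has dimension at most `n - 2`. -/
theorem dimH_finite_order_zeros_le {n N : ℕ} {U : Set (Euc n)} (hU : IsOpen U)
    {A : Fin n → Euc n → Matrix (Fin N) (Fin N) ℝ}
    (hA : ∀ j i l, ContDiffOn ℝ (⊤ : ℕ∞) (fun x => A j x i l) U) (hell : IsElliptic A U)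
    {B : Euc n → Matrix (Fin N) (Fin N) ℝ}
    (hB : ∀ i l, ContDiffOn ℝ (⊤ : ℕ∞) (fun x => B x i l) U)
    {ψ : Euc n → (Fin N → ℝ)} (hψ : ContDiffOn ℝ (⊤ : ℕ∞) ψ U)
    (heq : ∀ x ∈ U, linApply A B ψ x = 0) :
    dimH {x ∈ U | ψ x = 0 ∧ ∃ k, iteratedFDeriv ℝ k ψ x ≠ 0} ≤ (n : ℝ≥0∞) - 2 := by
  classical
  let S (m : ℕ) : Set (Euc n) :=
    {x ∈ U | (∀ i ≤ m, iteratedFDeriv ℝ i ψ x = 0) ∧ iteratedFDeriv ℝ (m + 1) ψ x ≠ 0}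
  have hsub : {x ∈ U | ψ x = 0 ∧ ∃ k, iteratedFDeriv ℝ k ψ x ≠ 0} ⊆ ⋃ m, S m := by
    rintro x ⟨hxU, hx, hk⟩
    obtain ⟨m, hm⟩ : ∃ m, Nat.find hk = m + 1 := Nat.exists_eq_succ_of_ne_zero fun h0 =>
      (h0 ▸ Nat.find_spec hk) (by ext; simp [hx])
    refine mem_iUnion.2 ⟨m, hxU, fun i hi => ?_, hm ▸ Nat.find_spec hk⟩
    exact not_not.1 (Nat.find_min hk (by omega))
  refine (dimH_mono hsub).trans ((dimH_iUnion S).trans_le (iSup_le fun m => ?_))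
  by_contra! hlt
  obtain ⟨p, ⟨hpU, hpvan, hpne⟩, hp⟩ := exists_mem_nhdsWithin_lt_dimH_of_lt_dimH hlt
  have hsmooth : ContDiffAt ℝ (⊤ : ℕ∞) (iteratedFDeriv ℝ m ψ) p :=
    (hψ.contDiffAt (hU.mem_nhds hpU)).iteratedFDeriv_right (by exact_mod_cast le_top)
  obtain ⟨t, ht, htdim⟩ := dimH_le_finrank_ker_of_hasStrictFDerivAt
    (hsmooth.hasStrictFDerivAt (by simp)) (S := S m) fun x hx => hx.2.1 m le_rfl
  have hL : fderiv ℝ (iteratedFDeriv ℝ m ψ) p ≠ 0 := fun h => hpne <| by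
    ext1 u
    simp [iteratedFDeriv_succ_apply_left, h]
  have hrank := finrank_ker_add_two_le_of_elliptic (hell p hpU) hL
    (sum_mulVec_fderiv_iteratedFDeriv_eq_zero hU hA hB hψ heq hpU hpvan)
  refine (hp t ht).not_ge (htdim.trans (ENNReal.le_sub_of_add_le_right (by simp) ?_))
  exact_mod_cast hrank

/-- (Strong Cauchy uniqueness.) Let `D` be a linear elliptic first-order
operator with the strong unique continuation property on an open connected `U ⊆ ℝⁿ`,
`n ≥ 2`. If two solutions of `Dφ = 0` agree on a subset `A ⊆ U` which is closed in `U`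
and has Hausdorff dimension `> n − 2`, then they agree on all of `U`. -/
theorem solutions_agreeing_on_large_set_coincide
    (n N : ℕ) (hn : 2 ≤ n) (hN : 1 ≤ N)
    (U : Set (Euc n)) (hUopen : IsOpen U) (hUconn : IsConnected U)
    (A : Fin n → Euc n → Matrix (Fin N) (Fin N) ℝ)
    (hA : ∀ j i l, ContDiffOn ℝ (⊤ : ℕ∞) (fun x => A j x i l) U)
    (hell : IsElliptic A U)
    (B : Euc n → Matrix (Fin N) (Fin N) ℝ)
    (hB : ∀ i l, ContDiffOn ℝ (⊤ : ℕ∞) (fun x => B x i l) U)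
    (hsucp : HasSUCPlin A B U)
    (Aset : Set (Euc n)) (hAsub : Aset ⊆ U)
    (hAclosed : IsClosed (Subtype.val ⁻¹' Aset : Set U))
    (hAdim : (n : ℝ≥0∞) - 2 < dimH Aset)
    (φ₁ φ₂ : Euc n → (Fin N → ℝ))
    (hφ₁ : ContDiffOn ℝ (⊤ : ℕ∞) φ₁ U) (hφ₂ : ContDiffOn ℝ (⊤ : ℕ∞) φ₂ U)
    (heq₁ : ∀ x ∈ U, linApply A B φ₁ x = 0)
    (heq₂ : ∀ x ∈ U, linApply A B φ₂ x = 0)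
    (hagree : ∀ x ∈ Aset, φ₁ x = φ₂ x) :
    ∀ x ∈ U, φ₁ x = φ₂ x := by
  have hψ : ContDiffOn ℝ (⊤ : ℕ∞) (fun x => φ₁ x - φ₂ x) U := hφ₁.sub hφ₂
  have heq : ∀ x ∈ U, linApply A B (fun x => φ₁ x - φ₂ x) x = 0 := fun x hx => by
    have hd₁ := (hφ₁.contDiffAt (hUopen.mem_nhds hx)).differentiableAt (by simp)
    have hd₂ := (hφ₂.contDiffAt (hUopen.mem_nhds hx)).differentiableAt (by simp)
    have hsub : linApply A B (fun x => φ₁ x - φ₂ x) x = linApply A B φ₁ x - linApply A B φ₂ x := by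
      simp only [linApply, fderiv_fun_sub hd₁ hd₂, sub_apply, Matrix.mulVec_sub,
        Finset.sum_sub_distrib]
      abel
    rw [hsub, heq₁ x hx, heq₂ x hx, sub_zero]
  obtain ⟨p, hpU, hp⟩ : ∃ p ∈ U, ∀ k, iteratedFDeriv ℝ k (fun x => φ₁ x - φ₂ x) p = 0 := by
    by_contra! h
    have hsub : Aset ⊆ {x ∈ U | φ₁ x - φ₂ x = 0 ∧
        ∃ k, iteratedFDeriv ℝ k (fun x => φ₁ x - φ₂ x) x ≠ 0} :=
      fun x hx => ⟨hAsub hx, sub_eq_zero.2 (hagree x hx), h x (hAsub hx)⟩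
    exact hAdim.not_ge ((dimH_mono hsub).trans
        (dimH_finite_order_zeros_le hUopen hA hell hB hψ heq))
  exact fun x hx => sub_eq_zero.1
    (hsucp U Subset.rfl hUopen hUconn _ hψ heq ⟨p, hpU, hp⟩ x hx)
end
end

section
/- Let n ≥ 1, let U ⊆ ℝⁿ be an open neighborhood of 0, and let f : U → ℝ be a smooth function vanishing at 0 to order exactly k with k ≥ 1 (i.e. iteratedFDeriv ℝ m f 0 = 0 for all m < k and iteratedFDeriv ℝ k f 0 ≠ 0). Then the (n−1)-dimensional upper Hausdorff density of the zero set N(f) = f⁻¹(0) at 0 satisfies Θ^{*(n−1)}(N(f), 0) ≤ (n · 2^{n−1} / α(n−1)) · k. -/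
open MeasureTheory Metric Set Filter Topology ENNReal NNReal

noncomputable section

/-- The Lebesgue volume `α(m)` of the unit ball in `ℝᵐ` (so `α(0) = 1`). -/
def unitBallVol (m : ℕ) : ℝ≥0∞ := volume (ball (0 : Euc m) 1)

/-- The `m`-dimensional upper Hausdorff density
`Θ^{*m}(S,p) = limsup_{r→0⁺} μH^m(S ∩ B(p,r))/(α(m) rᵐ)`. -/
def upperHausdorffDensity {n : ℕ} (m : ℕ) (S : Set (Euc n)) (p : Euc n) : ℝ≥0∞ :=
  limsup (fun r : ℝ =>
      μH[(m : ℝ)] (S ∩ ball p r) / (unitBallVol m * ENNReal.ofReal (r ^ m)))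
    (𝓝[>] (0 : ℝ))

section IteratedDerivatives

variable {E : Type*} [NormedAddCommGroup E] [NormedSpace ℝ E]

theorem ContDiffAt.iteratedFDeriv_apply_const {f : E → ℝ} {x : E}
    (hf : ContDiffAt ℝ (⊤ : ℕ∞) f x) (j : ℕ) (v : Fin j → E) :
    ContDiffAt ℝ (⊤ : ℕ∞) (fun y => iteratedFDeriv ℝ j f y v) x := by
  have h : ContDiffAt ℝ (⊤ : ℕ∞) (iteratedFDeriv ℝ j f) x :=
    hf.iteratedFDeriv_right (m := (⊤ : ℕ∞)) (i := j) (by exact_mod_cast le_top)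
  exact (ContinuousMultilinearMap.apply ℝ (fun _ : Fin j => E) ℝ v).contDiff.contDiffAt.comp x h

theorem ContDiffAt.iteratedFDeriv_succ_apply {f : E → ℝ} {x : E}
    (hf : ContDiffAt ℝ (⊤ : ℕ∞) f x) (j : ℕ) (v : Fin (j + 1) → E) :
    iteratedFDeriv ℝ (j + 1) f x v =
      fderiv ℝ (fun y => iteratedFDeriv ℝ j f y (Fin.tail v)) x (v 0) := by
  have h : ContDiffAt ℝ (⊤ : ℕ∞) (iteratedFDeriv ℝ j f) x :=
    hf.iteratedFDeriv_right (m := (⊤ : ℕ∞)) (i := j) (by exact_mod_cast le_top)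
  exact (h.differentiableAt (by simp)).iteratedFDeriv_succ_apply_left'

theorem iteratedFDeriv_comp_swap {f : E → ℝ} {U : Set E} (hU : IsOpen U)
    (hf : ContDiffOn ℝ (⊤ : ℕ∞) f U) {n : ℕ} (i : Fin n) {x : E} (hx : x ∈ U)
    (v : Fin (n + 1) → E) :
    iteratedFDeriv ℝ (n + 1) f x (v ∘ Equiv.swap i.castSucc i.succ) =
      iteratedFDeriv ℝ (n + 1) f x v := by
  have hfx : ∀ y ∈ U, ContDiffAt ℝ (⊤ : ℕ∞) f y := fun y hy => hf.contDiffAt (hU.mem_nhds hy)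
  induction n generalizing x with
  | zero => exact i.elim0
  | succ n ih =>
    rw [(hfx x hx).iteratedFDeriv_succ_apply, (hfx x hx).iteratedFDeriv_succ_apply]
    refine Fin.cases ?_ (fun i => ?_) i
    · have key : ∀ w : Fin (n + 2) → E,
          fderiv ℝ (fun y => iteratedFDeriv ℝ (n + 1) f y (Fin.tail w)) x (w 0) =
          fderiv ℝ (fderiv ℝ (fun y => iteratedFDeriv ℝ n f y (Fin.tail (Fin.tail w)))) x
            (w 0) (w 1) := by
        intro w
        have h1 : (fun y => iteratedFDeriv ℝ (n + 1) f y (Fin.tail w)) =ᶠ[𝓝 x] fun y =>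
            fderiv ℝ (fun y => iteratedFDeriv ℝ n f y (Fin.tail (Fin.tail w))) y (w 1) := by
          filter_upwards [hU.mem_nhds hx] with y hy
          rw [(hfx y hy).iteratedFDeriv_succ_apply]
          rfl
        rw [h1.fderiv_eq]
        have h2 : DifferentiableAt ℝ
            (fderiv ℝ (fun y => iteratedFDeriv ℝ n f y (Fin.tail (Fin.tail w)))) x :=
          (((hfx x hx).iteratedFDeriv_apply_const n _).fderiv_right (m := 1)
            (by norm_num; exact WithTop.coe_le_coe.2 le_top)).differentiableAt (by simp)
        rw [fderiv_clm_apply h2 (differentiableAt_const _)]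
        simp
      rw [key, key]
      have ht : Fin.tail (Fin.tail (v ∘ Equiv.swap (0 : Fin (n + 1)).castSucc
          (0 : Fin (n + 1)).succ)) = Fin.tail (Fin.tail v) := by
        funext j
        simp only [Fin.tail, Function.comp]
        rw [Equiv.swap_apply_of_ne_of_ne] <;> simp [Fin.ext_iff]
      rw [ht]
      have hs : IsSymmSndFDerivAt ℝ
          (fun y => iteratedFDeriv ℝ n f y (Fin.tail (Fin.tail v))) x :=
        ((hfx x hx).iteratedFDeriv_apply_const n _).isSymmSndFDerivAt 
          (by simp only [minSmoothness_of_isRCLikeNormedField]; exact WithTop.coe_le_coe.2 le_top)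
      rw [hs.eq]
      simp
    · have h0 : (v ∘ Equiv.swap i.succ.castSucc i.succ.succ) 0 = v 0 := by
        simp only [Function.comp]
        rw [Equiv.swap_apply_of_ne_of_ne] <;> simp [Fin.ext_iff]
      have ht : Fin.tail (v ∘ Equiv.swap i.succ.castSucc i.succ.succ) =
          Fin.tail v ∘ Equiv.swap i.castSucc i.succ := by
        funext j
        simp only [Fin.tail, Function.comp, ← Fin.succ_castSucc]
        rw [(Fin.succ_injective _).map_swap]
      rw [h0, ht]
      have h1 : (fun y => iteratedFDeriv ℝ (n + 1) f y
          (Fin.tail v ∘ Equiv.swap i.castSucc i.succ)) =ᶠ[𝓝 x]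
          fun y => iteratedFDeriv ℝ (n + 1) f y (Fin.tail v) := by
        filter_upwards [hU.mem_nhds hx] with y hy using ih i hy _
      rw [h1.fderiv_eq]

theorem ContDiffOn.iteratedFDeriv_comp_perm {f : E → ℝ} {U : Set E} (hU : IsOpen U)
    (hf : ContDiffOn ℝ (⊤ : ℕ∞) f U) {n : ℕ} {x : E} (hx : x ∈ U) (v : Fin n → E)
    (σ : Equiv.Perm (Fin n)) :
    iteratedFDeriv ℝ n f x (v ∘ σ) = iteratedFDeriv ℝ n f x v := by
  cases n with
  | zero => rw [Subsingleton.elim (v ∘ σ) v]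
  | succ n =>
    have hσ : σ ∈ Submonoid.closure
        (Set.range fun i : Fin n => Equiv.swap i.castSucc i.succ) := by
      rw [Equiv.Perm.mclosure_swap_castSucc_succ]; trivial
    induction hσ using Submonoid.closure_induction generalizing v with
    | mem τ hτ =>
      obtain ⟨i, rfl⟩ := hτ
      exact iteratedFDeriv_comp_swap hU hf i hx v
    | one => rfl
    | mul τ τ' _ _ h h' =>
      rw [Equiv.Perm.coe_mul, ← Function.comp_assoc, h', h]

theorem ContDiffOn.exists_iteratedFDeriv_diag_ne_zero {f : E → ℝ} {U : Set E} (hU : IsOpen U)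
    (hf : ContDiffOn ℝ (⊤ : ℕ∞) f U) {n : ℕ} {x : E} (hx : x ∈ U)
    (h : iteratedFDeriv ℝ n f x ≠ 0) : ∃ w : E, iteratedFDeriv ℝ n f x (fun _ => w) ≠ 0 := by
  by_contra! hw
  apply h
  ext v
  have h1 := ContinuousMultilinearMap.iteratedFDeriv_comp_diagonal (iteratedFDeriv ℝ n f x) x v
  have h2 : (fun y => iteratedFDeriv ℝ n f x (fun _ => y)) = fun _ => (0 : ℝ) := funext hw
  have h3 : ∀ σ : Equiv.Perm (Fin n), iteratedFDeriv ℝ n f x (fun i => v (σ i)) =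
      iteratedFDeriv ℝ n f x v := fun σ => ContDiffOn.iteratedFDeriv_comp_perm hU hf hx v σ
  rw [h2] at h1
  simp only [h3, Finset.sum_const, Finset.card_univ, Fintype.card_perm, Fintype.card_fin] at h1
  have h4 : iteratedFDeriv ℝ n (fun _ : E => (0 : ℝ)) x v = 0 := by
    simp
  rw [h4] at h1
  have := (Nat.factorial_pos n).ne'
  simpa [this] using h1.symm

end IteratedDerivatives

section OrthonormalBasis

variable {E : Type*} [NormedAddCommGroup E] [InnerProductSpace ℝ E]

theorem exists_rotation_ne_zero {k : ℕ} (M : E [×k]→L[ℝ] ℝ) (a : E) {b : E}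
    (hb : M (fun _ => b) ≠ 0) :
    ∃ θ : ℝ, M (fun _ => Real.cos θ • a + Real.sin θ • b) ≠ 0 ∧
      M (fun _ => Real.cos θ • b - Real.sin θ • a) ≠ 0 := by
  have hg : AnalyticOnNhd ℝ (fun θ : ℝ => M (fun _ => Real.cos θ • a + Real.sin θ • b)) univ := by
    intro θ _
    have h1 : AnalyticAt ℝ (fun θ : ℝ => Real.cos θ • a + Real.sin θ • b) θ :=
      (Real.analyticAt_cos.smul analyticAt_const).add
        (Real.analyticAt_sin.smul analyticAt_const)
    have h2 : AnalyticAt ℝ (fun θ : ℝ => fun _ : Fin k => Real.cos θ • a + Real.sin θ • b) θ :=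
      AnalyticAt.pi fun _ => h1
    exact M.analyticAt.comp h2
  have h1 : ∀ᶠ θ in 𝓝[≠] (0 : ℝ), M (fun _ => Real.cos θ • a + Real.sin θ • b) ≠ 0 := by
    refine (hg 0 trivial).eventually_eq_zero_or_eventually_ne_zero.resolve_left fun h => hb ?_
    have := hg.eqOn_zero_of_preconnected_of_eventuallyEq_zero isPreconnected_univ
      (mem_univ (0 : ℝ)) h (mem_univ (Real.pi / 2))
    simpa using this
  have h2 : ∀ᶠ θ in 𝓝[≠] (0 : ℝ), M (fun _ => Real.cos θ • b - Real.sin θ • a) ≠ 0 := by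
    have hc : Continuous fun θ : ℝ => M (fun _ => Real.cos θ • b - Real.sin θ • a) :=
      M.cont.comp (continuous_pi fun _ => by fun_prop)
    exact (hc.continuousAt.eventually_ne (by simpa using hb)).filter_mono nhdsWithin_le_nhds
  exact (h1.and h2).exists

theorem Orthonormal.rotate {ι : Type*} [DecidableEq ι] {v : ι → E} (hv : Orthonormal ℝ v)
    {i j : ι} (hij : i ≠ j) (θ : ℝ) :
    Orthonormal ℝ (Function.update (Function.update v i (Real.cos θ • v i + Real.sin θ • v j)) j
      (Real.cos θ • v j - Real.sin θ • v i)) := by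
  have hvv := orthonormal_iff_ite.1 hv
  have hcs := Real.sin_sq_add_cos_sq θ
  rw [orthonormal_iff_ite]
  intro p q
  have hji := hij.symm
  by_cases hpj : p = j <;> by_cases hpi : p = i <;> by_cases hqj : q = j <;> by_cases hqi : q = i <;>
    simp only [Function.update_apply, inner_add_left, inner_add_right, inner_sub_left,
      inner_sub_right, real_inner_smul_left, real_inner_smul_right, hvv, hpj, hpi, hqj, hqi, hij,
      hji, if_true, if_false] <;>
    grind

theorem exists_orthonormal_diag_ne_zero {ι : Type*} [Fintype ι] {k : ℕ} (M : E [×k]→L[ℝ] ℝ)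
    {v : ι → E} (hv : Orthonormal ℝ v) (hM : ∃ j, M (fun _ => v j) ≠ 0) :
    ∃ v' : ι → E, Orthonormal ℝ v' ∧ ∀ i, M (fun _ => v' i) ≠ 0 := by
  classical
  induction hN : (Finset.univ.filter fun i => M (fun _ => v i) = 0).card
    using Nat.strong_induction_on generalizing v with
  | _ N ih =>
    by_cases hall : ∀ i, M (fun _ => v i) ≠ 0
    · exact ⟨v, hv, hall⟩
    push Not at hall
    obtain ⟨i, hi⟩ := hall
    obtain ⟨j, hj⟩ := hM
    have hij : i ≠ j := by rintro rfl; exact hj hi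
    obtain ⟨θ, h1, h2⟩ := exists_rotation_ne_zero M (v i) hj
    refine ih _ ?_ (hv.rotate hij θ) ⟨j, by simpa using h2⟩ rfl
    rw [← hN]
    apply Finset.card_lt_card
    rw [Finset.ssubset_iff_of_subset]
    · exact ⟨i, by simpa using hi, by simpa [hij] using h1⟩
    · intro p
      simp only [Finset.mem_filter, Finset.mem_univ, true_and, Function.update_apply]
      split_ifs with hp hp'
      · exact fun h => absurd h h2
      · exact fun h => absurd h h1
      · exact id

theorem exists_orthonormalBasis_diag_ne_zero {n k : ℕ} (M : Euc n [×k]→L[ℝ] ℝ)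
    {w : Euc n} (hn : 1 ≤ n) (hw : M (fun _ => w) ≠ 0) :
    ∃ b : OrthonormalBasis (Fin n) ℝ (Euc n), ∀ i, M (fun _ => b i) ≠ 0 := by
  obtain ⟨u, hu1, hu⟩ : ∃ u : Euc n, ‖u‖ = 1 ∧ M (fun _ => u) ≠ 0 := by
    by_cases h0 : w = 0
    · rcases Nat.eq_zero_or_pos k with rfl | hk
      · refine ⟨EuclideanSpace.single ⟨0, hn⟩ 1, by simp, ?_⟩
        convert hw
      · exact absurd (M.map_coord_zero ⟨0, hk⟩ h0) hw
    · refine ⟨‖w‖⁻¹ • w, by simp [norm_smul, h0], ?_⟩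
      rw [M.map_smul_univ (fun _ => ‖w‖⁻¹) (fun _ => w)]
      simp [h0, hw]
  have hu' : Orthonormal ℝ (({⟨0, hn⟩} : Set (Fin n)).domRestrict fun _ : Fin n => u) := by
    rw [orthonormal_iff_ite]
    rintro ⟨p, rfl⟩ ⟨q, rfl⟩
    simp [hu1, Set.domRestrict]
  obtain ⟨b, hb⟩ := hu'.exists_orthonormalBasis_extension_of_card_eq (by simp)
  obtain ⟨v, hv, hvM⟩ := exists_orthonormal_diag_ne_zero M b.orthonormal
    ⟨⟨0, hn⟩, by rw [hb _ rfl]; exact hu⟩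
  have hv' : Orthonormal ℝ ((univ : Set (Fin n)).domRestrict v) :=
    hv.comp _ Subtype.val_injective
  obtain ⟨c, hc⟩ := hv'.exists_orthonormalBasis_extension_of_card_eq (by simp)
  exact ⟨c, fun i => by rw [hc i trivial]; exact hvM i⟩

end OrthonormalBasis

/-- A function whose `k`-th derivative has no zero on an interval has at most `k` zeros there. -/
theorem card_zeros_le_of_deriv_ne_zero {I : Set ℝ} (hI : I.OrdConnected) {k : ℕ}
    (φ : ℕ → ℝ → ℝ) (hφ : ∀ j < k, ∀ t ∈ I, HasDerivAt (φ j) (φ (j + 1) t) t)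
    (hk : ∀ t ∈ I, φ k t ≠ 0) (s : Finset ℝ) (hs : ∀ t ∈ s, t ∈ I ∧ φ 0 t = 0) :
    s.card ≤ k := by
  induction k generalizing φ s with
  | zero =>
    rw [Nat.le_zero, Finset.card_eq_zero, Finset.eq_empty_iff_forall_notMem]
    exact fun t ht => hk t (hs t ht).1 (hs t ht).2
  | succ k ih =>
    by_contra! hcard
    obtain ⟨N, hN⟩ : ∃ N, s.card = N + 1 := ⟨s.card - 1, by omega⟩
    let e := s.orderEmbOfFin hN
    have he : ∀ p, e p ∈ I ∧ φ 0 (e p) = 0 := fun p => hs _ (s.orderEmbOfFin_mem hN p)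
    have hlt : ∀ p : Fin N, e p.castSucc < e p.succ := fun p =>
      e.strictMono Fin.castSucc_lt_succ
    have hroll : ∀ p : Fin N, ∃ c ∈ Ioo (e p.castSucc) (e p.succ), φ 1 c = 0 := by
      intro p
      have hsub : Icc (e p.castSucc) (e p.succ) ⊆ I := hI.out (he _).1 (he _).1
      have hd : ∀ t ∈ Icc (e p.castSucc) (e p.succ), HasDerivAt (φ 0) (φ 1 t) t :=
        fun t ht => hφ 0 (Nat.succ_pos _) t (hsub ht)
      exact exists_hasDerivAt_eq_zero (hlt p)
        (fun t ht => (hd t ht).continuousAt.continuousWithinAt) ((he _).2.trans (he _).2.symm)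
        fun t ht => hd t (Ioo_subset_Icc_self ht)
    choose c hc hc0 using hroll
    have hcm : StrictMono c := by
      intro p q hpq
      have h1 : e p.succ ≤ e q.castSucc := e.monotone (Fin.succ_le_castSucc_iff.2 hpq)
      exact (hc p).2.trans_le (h1.trans (hc q).1.le)
    have := ih (fun j => φ (j + 1)) (fun j hj t ht => hφ (j + 1) (by omega) t ht) hk
      (Finset.univ.map ⟨c, hcm.injective⟩) (by
        intro t ht
        obtain ⟨p, -, rfl⟩ := Finset.mem_map.1 ht
        exact ⟨hI.out (he _).1 (he _).1 (Ioo_subset_Icc_self (hc p)), hc0 p⟩)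
    simp only [Finset.card_map, Finset.card_univ, Fintype.card_fin] at this
    omega

section UnitBall

theorem ediam_closedBall_le_ofReal {X : Type*} [PseudoMetricSpace X] (x : X) (r : ℝ) :
    ediam (closedBall x r) ≤ ENNReal.ofReal (2 * r) := by
  refine ediam_le fun y hy z hz => ?_
  rw [edist_dist]
  refine ENNReal.ofReal_le_ofReal ?_
  have h1 := dist_triangle_right y z x
  rw [mem_closedBall] at hy hz
  linarith

theorem tsum_radius_pow_le_one {m : ℕ} {t : Set (Euc m)} (ht : t.Countable) {r : Euc m → ℝ}
    (hr : ∀ x ∈ t, 0 ≤ r x) (hsub : ∀ x ∈ t, closedBall x (r x) ⊆ ball 0 1)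
    (hd : t.PairwiseDisjoint fun x => closedBall x (r x)) :
    ∑' x : t, ENNReal.ofReal (r x ^ m) ≤ 1 := by
  have hV0 : (volume : Measure (Euc m)) (ball 0 1) ≠ 0 := (measure_ball_pos _ _ one_pos).ne'
  have hVt : (volume : Measure (Euc m)) (ball 0 1) ≠ ∞ := measure_ball_lt_top.ne
  have h1 : ∑' x : t, volume (closedBall (x : Euc m) (r x)) ≤ volume (ball (0 : Euc m) 1) := by
    rw [← measure_biUnion ht hd fun x _ => isClosed_closedBall.measurableSet]
    exact measure_mono (iUnion₂_subset hsub)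
  have h2 : ∀ x : t, volume (closedBall (x : Euc m) (r x)) =
      ENNReal.ofReal (r x ^ m) * volume (ball (0 : Euc m) 1) := fun x => by
    rw [Measure.addHaar_closedBall _ _ (hr x x.2), finrank_euclideanSpace_fin]
  simp only [h2] at h1
  rw [ENNReal.tsum_mul_right] at h1
  refine (ENNReal.mul_le_mul_iff_left hV0 hVt).1 ?_
  rwa [one_mul]

theorem hausdorffMeasure_unitBall_le (m : ℕ) :
    (μH[(m : ℝ)] : Measure (Euc m)) (ball 0 1) ≤ 2 ^ m := by
  set s : Set (Euc m) := ball 0 1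
  have hcov (n : ℕ) := Besicovitch.exists_disjoint_closedBall_covering_ae
    (μH[(m : ℝ)] : Measure (Euc m)) (fun x => {ρ | closedBall x ρ ⊆ s}) s
    (by
      intro x hx δ hδ
      obtain ⟨ε, hε, hsub⟩ := nhds_basis_closedBall.mem_iff.1 (isOpen_ball.mem_nhds hx)
      refine ⟨min ε (δ / 2), (closedBall_subset_closedBall (min_le_left _ _)).trans hsub,
        lt_min hε (by positivity), (min_le_right _ _).trans_lt (by linarith)⟩)
    (fun _ => 1 / ((n : ℝ) + 1)) (fun _ _ => by positivity)
  choose t r htc hts hr hnull hdisj using hcov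
  set s' : Set (Euc m) := ⋂ n, ⋃ x ∈ t n, closedBall x (r n x)
  have hs' : (μH[(m : ℝ)] : Measure (Euc m)) (s \ s') = 0 := by
    rw [show s \ s' = ⋃ n, s \ ⋃ x ∈ t n, closedBall x (r n x) from sdiff_iInter _ _]
    exact measure_iUnion_null hnull
  calc (μH[(m : ℝ)] : Measure (Euc m)) s ≤ μH[(m : ℝ)] (s \ s') + μH[(m : ℝ)] s' :=
        (measure_mono (by intro x hx; by_cases h : x ∈ s' <;> simp [h, hx])).trans
          (measure_union_le _ _)
    _ = μH[(m : ℝ)] s' := by rw [hs', zero_add]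
    _ ≤ liminf (fun n => ∑' i : t n, ediam (closedBall (i : Euc m) (r n i)) ^ (m : ℝ)) atTop := by
        have : ∀ n, Countable (t n) := fun n => (htc n).to_subtype
        refine Measure.hausdorffMeasure_le_liminf_tsum (m : ℝ) s'
          (fun n : ℕ => ENNReal.ofReal (2 * (1 / ((n : ℝ) + 1)))) ?_
          (fun n (i : t n) => closedBall (i : Euc m) (r n i)) ?_ ?_
        · have := (tendsto_one_div_add_atTop_nhds_zero_nat (𝕜 := ℝ)).const_mul 2
          simpa using ENNReal.tendsto_ofReal this
        · refine Eventually.of_forall fun n i =>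
            (ediam_closedBall_le_ofReal _ _).trans (ENNReal.ofReal_le_ofReal ?_)
          have := (hr n i i.2).2.2
          linarith
        · refine Eventually.of_forall fun n => ?_
          rw [← biUnion_eq_iUnion (t n) (fun x _ => closedBall x (r n x))]
          exact iInter_subset _ n
    _ ≤ liminf (fun _ : ℕ => (2 : ℝ≥0∞) ^ m) atTop := by
        refine liminf_le_liminf (Eventually.of_forall fun n => ?_)
        calc ∑' i : t n, ediam (closedBall (i : Euc m) (r n i)) ^ (m : ℝ)
            ≤ ∑' i : t n, 2 ^ m * ENNReal.ofReal (r n i ^ m) := by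
              refine ENNReal.tsum_le_tsum fun i => ?_
              have hpos := (hr n i i.2).2.1
              rw [ENNReal.rpow_natCast, ENNReal.ofReal_pow hpos.le, ← mul_pow]
              gcongr
              refine (ediam_closedBall_le_ofReal _ _).trans ?_
              rw [ENNReal.ofReal_mul two_pos.le, ENNReal.ofReal_ofNat]
          _ ≤ 2 ^ m * 1 := by
              rw [ENNReal.tsum_mul_left]
              gcongr
              exact tsum_radius_pow_le_one (htc n) (fun x hx => (hr n x hx).2.1.le)
                (fun x hx => (hr n x hx).1) (hdisj n)
          _ = 2 ^ m := mul_one _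
    _ = 2 ^ m := liminf_const _

theorem hausdorffMeasure_ball_le (m : ℕ) (x : Euc m) {r : ℝ} (hr : 0 < r) :
    (μH[(m : ℝ)] : Measure (Euc m)) (ball x r) ≤ 2 ^ m * ENNReal.ofReal (r ^ m) := by
  rw [Measure.addHaar_ball_of_pos _ _ hr, finrank_euclideanSpace_fin, mul_comm]
  gcongr
  exact hausdorffMeasure_unitBall_le m

end UnitBall

section FlatSets

variable {m : ℕ}

/-- The coordinate projection `ℝ^(m+1) → ℝ^m` forgetting the `i`-th coordinate. -/
def dropCoord (i : Fin (m + 1)) : Euc (m + 1) →L[ℝ] Euc m :=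
  LinearMap.toContinuousLinearMap
    { toFun := fun x => WithLp.toLp 2 fun j => x (i.succAbove j)
      map_add' := fun _ _ => rfl
      map_smul' := fun _ _ => rfl }

@[simp]
theorem dropCoord_apply (i : Fin (m + 1)) (x : Euc (m + 1)) (j : Fin m) :
    dropCoord i x j = x (i.succAbove j) := rfl

theorem norm_sq_eq_dropCoord (i : Fin (m + 1)) (x : Euc (m + 1)) :
    ‖x‖ ^ 2 = x i ^ 2 + ‖dropCoord i x‖ ^ 2 := by
  simp [EuclideanSpace.norm_sq_eq, Fin.sum_univ_succAbove _ i]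

theorem norm_dropCoord_le (i : Fin (m + 1)) (x : Euc (m + 1)) : ‖dropCoord i x‖ ≤ ‖x‖ := by
  refine le_of_sq_le_sq ?_ (norm_nonneg _)
  rw [norm_sq_eq_dropCoord i x]
  nlinarith [sq_nonneg (x i)]

/-- The matrix whose columns are the vectors `b 1, …, b m` with the `i`-th coordinate removed. -/
def minorMatrix (b : OrthonormalBasis (Fin (m + 1)) ℝ (Euc (m + 1))) (i : Fin (m + 1)) :
    Matrix (Fin m) (Fin m) ℝ :=
  Matrix.of fun r c => b c.succ (i.succAbove r)

theorem one_le_sum_abs_det_minorMatrix (b : OrthonormalBasis (Fin (m + 1)) ℝ (Euc (m + 1))) :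
    1 ≤ ∑ i, |(minorMatrix b i).det| := by
  set B : Matrix (Fin (m + 1)) (Fin (m + 1)) ℝ := Matrix.of fun r c => b c r
  have hB : |B.det| = 1 := by
    have h := (EuclideanSpace.basisFun (Fin (m + 1)) ℝ).det_to_matrix_orthonormalBasis_real b
    rw [Module.Basis.det_apply] at h
    have hBe : (EuclideanSpace.basisFun (Fin (m + 1)) ℝ).toBasis.toMatrix b = B := by
      ext r c
      simp [Module.Basis.toMatrix_apply, B]
    rw [hBe] at h
    rcases h with h | h <;> simp [h]
  rw [← hB, Matrix.det_succ_column_zero]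
  refine (Finset.abs_sum_le_sum_abs _ _).trans (Finset.sum_le_sum fun i _ => ?_)
  have hb : |b 0 i| ≤ 1 := by
    have := PiLp.norm_apply_le (b 0) i
    rwa [b.norm_eq_one, Real.norm_eq_abs] at this
  have hsub : B.submatrix i.succAbove Fin.succ = minorMatrix b i := rfl
  rw [hsub, abs_mul, abs_mul, abs_pow, abs_neg, abs_one, one_pow, one_mul]
  exact mul_le_of_le_one_left (abs_nonneg _) hb

theorem det_toEuclideanCLM (N : Matrix (Fin m) (Fin m) ℝ) :
    (Matrix.toEuclideanCLM (𝕜 := ℝ) N).det = N.det := by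
  rw [ContinuousLinearMap.det, Matrix.coe_toEuclideanCLM_eq_toEuclideanLin]
  change LinearMap.det (Matrix.toLpLin 2 2 N) = _
  rw [Matrix.toLpLin_eq_toLin, LinearMap.det_toLin]

/-- The coordinates of `x` along the vectors `b 1, …, b m` of an orthonormal basis `b`. -/
def tangentCoord (b : OrthonormalBasis (Fin (m + 1)) ℝ (Euc (m + 1))) (x : Euc (m + 1)) : Euc m :=
  dropCoord 0 (b.repr x)

theorem norm_le_abs_inner_add_norm_tangentCoord
    (b : OrthonormalBasis (Fin (m + 1)) ℝ (Euc (m + 1))) (x : Euc (m + 1)) :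
    ‖x‖ ≤ |inner ℝ (b 0) x| + ‖tangentCoord b x‖ := by
  refine le_of_sq_le_sq ?_ (by positivity)
  have h := norm_sq_eq_dropCoord 0 (b.repr x)
  rw [b.repr.norm_map, b.repr_apply_apply, ← sq_abs (inner ℝ (b 0) x)] at h
  rw [h]
  change _ + ‖tangentCoord b x‖ ^ 2 ≤ _
  nlinarith [abs_nonneg (inner ℝ (b 0) x), norm_nonneg (tangentCoord b x),
    mul_nonneg (abs_nonneg (inner ℝ (b 0) x)) (norm_nonneg (tangentCoord b x))]

theorem norm_dropCoord_sub_minorMatrix_le (b : OrthonormalBasis (Fin (m + 1)) ℝ (Euc (m + 1)))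
    (i : Fin (m + 1)) (x : Euc (m + 1)) :
    ‖dropCoord i x - Matrix.toEuclideanCLM (𝕜 := ℝ) (minorMatrix b i) (tangentCoord b x)‖ ≤
      |inner ℝ (b 0) x| := by
  have h : dropCoord i x - Matrix.toEuclideanCLM (𝕜 := ℝ) (minorMatrix b i) (tangentCoord b x) =
      inner ℝ (b 0) x • dropCoord i (b 0) := by
    rw [sub_eq_iff_eq_add]
    ext r
    conv_lhs => rw [← b.sum_repr' x]
    simp [Fin.sum_univ_succ, Matrix.mulVec, dotProduct, minorMatrix, tangentCoord,
      b.repr_apply_apply, mul_comm]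
  rw [h, norm_smul, Real.norm_eq_abs]
  refine mul_le_of_le_one_right (abs_nonneg _) ((norm_dropCoord_le _ _).trans ?_)
  rw [b.norm_eq_one]

theorem exists_abs_det_mul_le_image (A : Euc m →L[ℝ] Euc m) {C : ℝ≥0} (hC : 1 < C) :
    ∃ δ : ℝ≥0, 0 < δ ∧ ∀ (s : Set (Euc m)) (g : Euc m → Euc m), ApproximatesLinearOn g A s δ →
      ENNReal.ofReal |A.det| * μH[(m : ℝ)] s ≤ C * μH[(m : ℝ)] (g '' s) := by
  by_cases hA : A.det = 0
  · exact ⟨1, one_pos, fun s g _ => by simp [hA]⟩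
  have hlt : ((Real.toNNReal |A.det| / C : ℝ≥0) : ℝ≥0∞) < ENNReal.ofReal |A.det| := by
    rw [ENNReal.ofReal, ENNReal.coe_lt_coe]
    exact div_lt_self (by simpa using hA) hC
  obtain ⟨δ, h, hδ⟩ :=
    ((mul_le_addHaar_image_of_lt_det (μH[(m : ℝ)] : Measure (Euc m)) A hlt).and
      self_mem_nhdsWithin).exists
  refine ⟨δ, hδ, fun s g hg => ?_⟩
  have hC0 : C ≠ 0 := (one_pos.trans hC).ne'
  calc ENNReal.ofReal |A.det| * μH[(m : ℝ)] s
      = C * (((Real.toNNReal |A.det| / C : ℝ≥0) : ℝ≥0∞) * μH[(m : ℝ)] s) := by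
        rw [← mul_assoc, ← ENNReal.coe_mul, mul_div_cancel₀ _ hC0, ENNReal.ofReal]
    _ ≤ C * μH[(m : ℝ)] (g '' s) := by gcongr; exact h s g hg

/-- Any sufficiently flat set has Hausdorff measure at most, up to a factor close to `1`, the sum
of the measures of its projections to the coordinate hyperplanes. -/
theorem exists_hausdorffMeasure_le_sum_dropCoord {ν : Euc (m + 1)} (hν : ‖ν‖ = 1) {C : ℝ≥0}
    (hC : 1 < C) :
    ∃ ε : ℝ, 0 < ε ∧ ∀ S : Set (Euc (m + 1)),
      (∀ x ∈ S, ∀ y ∈ S, |inner ℝ ν (x - y)| ≤ ε * ‖x - y‖) →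
      μH[(m : ℝ)] S ≤ C * (C * ∑ i, μH[(m : ℝ)] (dropCoord i '' S)) := by
  have hν' : Orthonormal ℝ (({0} : Set (Fin (m + 1))).domRestrict fun _ => ν) := by
    rw [orthonormal_iff_ite]
    rintro ⟨p, rfl⟩ ⟨q, rfl⟩
    simp [hν, Set.domRestrict]
  obtain ⟨b, hb⟩ := hν'.exists_orthonormalBasis_extension_of_card_eq (by simp)
  obtain rfl : b 0 = ν := hb 0 rfl
  let A := fun i => Matrix.toEuclideanCLM (𝕜 := ℝ) (minorMatrix b i)
  choose δ hδ hA using fun i => exists_abs_det_mul_le_image (A i) hC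
  have h1 : ∀ᶠ ε in 𝓝[>] (0 : ℝ), ε < 1 / 2 :=
    nhdsWithin_le_nhds (gt_mem_nhds (by norm_num))
  have h2 : ∀ᶠ ε in 𝓝[>] (0 : ℝ), ∀ i, 2 * ε < (δ i : ℝ) := by
    rw [eventually_all]
    intro i
    have : Tendsto (fun ε : ℝ => 2 * ε) (𝓝 0) (𝓝 (2 * 0)) := tendsto_id.const_mul 2
    exact nhdsWithin_le_nhds (this.eventually_lt_const (by simpa using hδ i))
  have h3 : ∀ᶠ ε in 𝓝[>] (0 : ℝ), ((1 - ε)⁻¹) ^ m < (C : ℝ) := by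
    have : ContinuousAt (fun ε : ℝ => ((1 - ε)⁻¹) ^ m) 0 := by
      refine ContinuousAt.pow (ContinuousAt.inv₀ (by fun_prop) (by norm_num)) m
    exact nhdsWithin_le_nhds (this.eventually_lt_const (by simpa using hC))
  obtain ⟨ε, h1, h2, h3, hε⟩ := (h1.and (h2.and (h3.and self_mem_nhdsWithin))).exists
  replace hε : 0 < ε := hε
  refine ⟨ε, hε, fun S hS => ?_⟩
  have hT : ∀ x ∈ S, ∀ y ∈ S,
      (1 - ε) * ‖x - y‖ ≤ ‖tangentCoord b x - tangentCoord b y‖ := by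
    intro x hx y hy
    have h := norm_le_abs_inner_add_norm_tangentCoord b (x - y)
    have hs : tangentCoord b (x - y) = tangentCoord b x - tangentCoord b y := by
      simp [tangentCoord]
    rw [hs] at h
    linarith [hS x hx y hy]
  have hinj : InjOn (tangentCoord b) S := by
    intro x hx y hy hxy
    have := hT x hx y hy
    rw [hxy, sub_self, norm_zero] at this
    have h0 : ‖x - y‖ ≤ 0 := by nlinarith [norm_nonneg (x - y)]
    exact sub_eq_zero.1 (norm_le_zero_iff.1 h0)
  set T := tangentCoord b '' S
  set g := Function.invFunOn (tangentCoord b) S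
  have hg : ∀ x ∈ S, g (tangentCoord b x) = x := fun x hx => hinj.leftInvOn_invFunOn hx
  have hgT : g '' T = S := hinj.invFunOn_image subset_rfl
  have hK : (0 : ℝ) ≤ (1 - ε)⁻¹ := inv_nonneg.2 (by linarith)
  have hlip : LipschitzOnWith (Real.toNNReal (1 - ε)⁻¹) g T := by
    refine LipschitzOnWith.of_dist_le_mul ?_
    rintro _ ⟨x, hx, rfl⟩ _ ⟨y, hy, rfl⟩
    rw [hg x hx, hg y hy, dist_eq_norm, dist_eq_norm, Real.coe_toNNReal _ hK,
      ← div_eq_inv_mul, le_div_iff₀ (by linarith), mul_comm]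
    exact hT x hx y hy
  have happ : ∀ i, ApproximatesLinearOn (fun w => dropCoord i (g w)) (A i) T (δ i) := by
    rintro i _ ⟨x, hx, rfl⟩ _ ⟨y, hy, rfl⟩
    beta_reduce
    rw [hg x hx, hg y hy]
    have hs : tangentCoord b (x - y) = tangentCoord b x - tangentCoord b y := by
      simp [tangentCoord]
    have h := norm_dropCoord_sub_minorMatrix_le b i (x - y)
    rw [hs, map_sub] at h
    have h4 := hS x hx y hy
    have h5 := hT x hx y hy
    have h6 := h2 i
    refine h.trans (h4.trans ?_)
    have h7 : ‖x - y‖ ≤ 2 * ‖tangentCoord b x - tangentCoord b y‖ := by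
      nlinarith [norm_nonneg (x - y)]
    calc ε * ‖x - y‖ ≤ ε * (2 * ‖tangentCoord b x - tangentCoord b y‖) := by gcongr
      _ = 2 * ε * ‖tangentCoord b x - tangentCoord b y‖ := by ring
      _ ≤ _ := by gcongr
  have himg : ∀ i, (fun w => dropCoord i (g w)) '' T = dropCoord i '' S := by
    intro i
    rw [image_image]
    exact image_congr fun x hx => by rw [hg x hx]
  calc μH[(m : ℝ)] S = μH[(m : ℝ)] (g '' T) := by rw [hgT]
    _ ≤ (Real.toNNReal (1 - ε)⁻¹ : ℝ≥0∞) ^ (m : ℝ) * μH[(m : ℝ)] T :=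
        hlip.hausdorffMeasure_image_le (Nat.cast_nonneg m)
    _ ≤ C * μH[(m : ℝ)] T := by
        gcongr
        rw [ENNReal.rpow_natCast, ← ENNReal.coe_pow, ENNReal.coe_le_coe, ← NNReal.coe_le_coe,
          NNReal.coe_pow, Real.coe_toNNReal _ hK]
        exact h3.le
    _ ≤ C * ((∑ i, ENNReal.ofReal |(A i).det|) * μH[(m : ℝ)] T) := by
        gcongr
        refine le_mul_of_one_le_left' ?_
        rw [← ENNReal.ofReal_sum_of_nonneg fun i _ => abs_nonneg _, ENNReal.one_le_ofReal]
        simp only [A, det_toEuclideanCLM]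
        exact one_le_sum_abs_det_minorMatrix b
    _ ≤ C * (C * ∑ i, μH[(m : ℝ)] (dropCoord i '' S)) := by
        gcongr (C : ℝ≥0∞) * ?_
        rw [Finset.sum_mul, Finset.mul_sum]
        refine Finset.sum_le_sum fun i _ => ?_
        rw [← himg i]
        exact hA i T _ (happ i)

end FlatSets

theorem IsLocallyClosed.measurableSet_image {X Y : Type*} [TopologicalSpace X]
    [LocallyCompactSpace X] [SecondCountableTopology X] [TopologicalSpace Y] [T2Space Y]
    [MeasurableSpace Y] [BorelSpace Y] {s : Set X} (hs : IsLocallyClosed s) {g : X → Y}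
    (hg : Continuous g) : MeasurableSet (g '' s) := by
  have := hs.locallyCompactSpace
  obtain ⟨K, hK, hKs⟩ := (isSigmaCompact_iff_sigmaCompactSpace.2
    (inferInstance : SigmaCompactSpace s)).image hg
  rw [← hKs]
  exact .iUnion fun i => (hK i).measurableSet

theorem exists_isOpen_hausdorffMeasure_le {m : ℕ} {S : Set (Euc (m + 1))} {p : Euc (m + 1)}
    {F : Euc (m + 1) → ℝ} {F' : Euc (m + 1) →L[ℝ] ℝ} (hF : HasStrictFDerivAt F F' p)
    (hF' : F' ≠ 0) (hS : ∀ x ∈ S, F x = 0) {C : ℝ≥0} (hC : 1 < C) :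
    ∃ V : Set (Euc (m + 1)), IsOpen V ∧ p ∈ V ∧ ∀ E ⊆ S ∩ V,
      μH[(m : ℝ)] E ≤ C * (C * ∑ i, μH[(m : ℝ)] (dropCoord i '' E)) := by
  set w := (InnerProductSpace.toDual ℝ (Euc (m + 1))).symm F'
  have hw : ∀ x, inner ℝ w x = F' x := fun x => InnerProductSpace.toDual_symm_apply
  have hw0 : 0 < ‖w‖ := by simpa [w] using hF'
  obtain ⟨ε, hε, hflat⟩ := exists_hausdorffMeasure_le_sum_dropCoord
    (ν := ‖w‖⁻¹ • w) (by rw [norm_smul, norm_inv, norm_norm, inv_mul_cancel₀ hw0.ne']) hC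
  have h := hF.isLittleO.def (mul_pos hε hw0)
  rw [nhds_prod_eq, Filter.Eventually, mem_prod_same_iff] at h
  obtain ⟨t, ht, htF⟩ := h
  obtain ⟨V, hVt, hVo, hpV⟩ := _root_.mem_nhds_iff.1 ht
  refine ⟨V, hVo, hpV, fun E hE => hflat E fun x hx y hy => ?_⟩
  have h1 := htF (mk_mem_prod (hVt (hE hx).2) (hVt (hE hy).2))
  simp only [mem_ofPred_eq, hS x (hE hx).1, hS y (hE hy).1, sub_self, zero_sub,
    Real.norm_eq_abs, abs_neg] at h1
  rw [real_inner_smul_left, hw, abs_mul, abs_inv, abs_norm, inv_mul_le_iff₀ hw0]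
  linarith

theorem exists_partition_hausdorffMeasure_le {m : ℕ} {S : Set (Euc (m + 1))}
    (hSl : IsLocallyClosed S) {F : Euc (m + 1) → ℝ}
    (hF : ∀ p ∈ S, ∃ F' : Euc (m + 1) →L[ℝ] ℝ, HasStrictFDerivAt F F' p ∧ F' ≠ 0) (hS : ∀ x ∈ S, F x = 0)
    {C : ℝ≥0} (hC : 1 < C) :
    ∃ E : ℕ → Set (Euc (m + 1)), Pairwise (Function.onFun Disjoint E) ∧ ⋃ l, E l = S ∧
      (∀ l i, MeasurableSet (dropCoord i '' E l)) ∧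
      ∀ l, μH[(m : ℝ)] (E l) ≤ C * (C * ∑ i, μH[(m : ℝ)] (dropCoord i '' E l)) := by
  rcases S.eq_empty_or_nonempty with rfl | hne
  · exact ⟨fun _ => ∅, fun _ _ _ => by simp [Function.onFun], by simp, by simp, by simp⟩
  have key : ∀ p ∈ S, ∃ V : Set (Euc (m + 1)), IsOpen V ∧ p ∈ V ∧ ∀ E ⊆ S ∩ V,
      μH[(m : ℝ)] E ≤ C * (C * ∑ i, μH[(m : ℝ)] (dropCoord i '' E)) := by
    intro p hp
    obtain ⟨F', h1, h2⟩ := hF p hp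
    exact exists_isOpen_hausdorffMeasure_le h1 h2 hS hC
  choose! V hVo hpV hV using key
  obtain ⟨t, htS, htc, ht⟩ := TopologicalSpace.countable_cover_nhdsWithin
    (fun p hp => mem_nhdsWithin_of_mem_nhds ((hVo p hp).mem_nhds (hpV p hp)))
  have htne : t.Nonempty := by
    by_contra h
    rw [not_nonempty_iff_eq_empty] at h
    simp [h] at ht
    exact hne.ne_empty ht
  obtain ⟨a, rfl⟩ := htc.exists_eq_range htne
  have ha : ∀ l, a l ∈ S := fun l => htS (mem_range_self l)
  refine ⟨disjointed fun l => S ∩ V (a l), disjoint_disjointed _, ?_, fun l i => ?_, fun l =>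
    hV (a l) (ha l) _ (disjointed_subset _ l)⟩
  · rw [iUnion_disjointed, ← inter_iUnion]
    refine inter_eq_left.2 ?_
    simpa using ht
  · refine IsLocallyClosed.measurableSet_image ?_ (dropCoord i).continuous
    have : disjointed (fun l => S ∩ V (a l)) l = S ∩ (V (a l) ∩ (⋃ j < l, V (a j))ᶜ) := by
      rw [disjointed_eq_inter_compl]
      ext x
      simp
      tauto
    rw [this]
    refine hSl.inter ((hVo _ (ha l)).isLocallyClosed.inter ?_)
    exact (isOpen_biUnion fun j _ => hVo _ (ha j)).isClosed_compl.isLocallyClosed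

theorem tsum_measure_image_le {X Y ι : Type*} [MeasurableSpace Y] [Countable ι] (μ : Measure Y)
    (g : X → Y) {E : ι → Set X} (hE : Pairwise (Function.onFun Disjoint E))
    (hEm : ∀ l, MeasurableSet (g '' E l)) {T : Set Y} (hT : MeasurableSet T)
    (hET : ∀ l, MapsTo g (E l) T) {k : ℕ}
    (hk : ∀ (y : Y) (s : Finset X), (∀ x ∈ s, (∃ l, x ∈ E l) ∧ g x = y) → s.card ≤ k) :
    ∑' l, μ (g '' E l) ≤ k * μ T := by
  classical
  rcases isEmpty_or_nonempty X with hX | hX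
  · simp [eq_empty_of_isEmpty]
  calc ∑' l, μ (g '' E l) = ∑' l, ∫⁻ y, (g '' E l).indicator 1 y ∂μ := by
        simp_rw [lintegral_indicator_one (hEm _)]
    _ = ∫⁻ y, ∑' l, (g '' E l).indicator 1 y ∂μ :=
        (lintegral_tsum fun l => (measurable_one.indicator (hEm l)).aemeasurable).symm
    _ ≤ ∫⁻ y, T.indicator (fun _ => (k : ℝ≥0∞)) y ∂μ := by
        refine lintegral_mono fun y => ?_
        rw [ENNReal.tsum_eq_iSup_sum]
        refine iSup_le fun s => ?_
        simp only [indicator_apply, Pi.one_apply, Finset.sum_boole]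
        split_ifs with hy
        · have hx : ∀ l ∈ s.filter fun l => y ∈ g '' E l, ∃ x ∈ E l, g x = y :=
            fun l hl => (Finset.mem_filter.1 hl).2
          choose! x hxE hxg using hx
          rw [← Finset.card_image_of_injOn (f := x)]
          · refine Nat.cast_le.2 (hk y _ fun z hz => ?_)
            obtain ⟨l, hl, rfl⟩ := Finset.mem_image.1 hz
            exact ⟨⟨l, hxE l hl⟩, hxg l hl⟩
          · intro l hl l' hl' h
            by_contra hne
            exact disjoint_left.1 (hE hne) (hxE l hl) (h ▸ hxE l' hl')
        · rw [Finset.filter_false_of_mem]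
          · simp
          · rintro l - ⟨x, hx, rfl⟩
            exact hy (hET l hx)
    _ = k * μ T := by rw [lintegral_indicator_const hT]

theorem IsOpen.isLocallyClosed_setOf_eq {X Y : Type*} [TopologicalSpace X] [TopologicalSpace Y]
    [T1Space Y] {B : Set X} (hB : IsOpen B) {g : X → Y} (hg : ContinuousOn g B) (c : Y) :
    IsLocallyClosed {x ∈ B | g x = c} := by
  obtain ⟨Z, hZ, h⟩ := continuousOn_iff_isClosed.1 hg {c} isClosed_singleton
  refine ⟨B, Z, hB, hZ, ?_⟩
  rw [inter_comm, ← h]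
  ext x
  simp [and_comm]

section DirectionalDerivatives

variable {m k : ℕ} {B : Set (Euc (m + 1))} {f : Euc (m + 1) → ℝ}

/-- The `j`-th derivative of `f` at `x` in the direction of the `i`-th coordinate vector. -/
def coordDeriv (f : Euc (m + 1) → ℝ) (i : Fin (m + 1)) (j : ℕ) (x : Euc (m + 1)) : ℝ :=
  iteratedFDeriv ℝ j f x fun _ => EuclideanSpace.single i 1

theorem coordDeriv_zero (i : Fin (m + 1)) (x : Euc (m + 1)) : coordDeriv f i 0 x = f x := by
  simp [coordDeriv]

theorem contDiffAt_coordDeriv {x : Euc (m + 1)} (hf : ContDiffAt ℝ (⊤ : ℕ∞) f x)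
    (i : Fin (m + 1)) (j : ℕ) : ContDiffAt ℝ (⊤ : ℕ∞) (coordDeriv f i j) x :=
  hf.iteratedFDeriv_apply_const j _

theorem hasStrictFDerivAt_coordDeriv {x : Euc (m + 1)} (hf : ContDiffAt ℝ (⊤ : ℕ∞) f x)
    (i : Fin (m + 1)) (j : ℕ) :
    HasStrictFDerivAt (coordDeriv f i j) (fderiv ℝ (coordDeriv f i j) x) x :=
  (contDiffAt_coordDeriv hf i j).hasStrictFDerivAt (by simp)

theorem fderiv_coordDeriv_single {x : Euc (m + 1)} (hf : ContDiffAt ℝ (⊤ : ℕ∞) f x)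
    (i : Fin (m + 1)) (j : ℕ) :
    fderiv ℝ (coordDeriv f i j) x (EuclideanSpace.single i 1) = coordDeriv f i (j + 1) x :=
  (hf.iteratedFDeriv_succ_apply j fun _ => EuclideanSpace.single i 1).symm

/-- A convex set meets the zero set of `f`, on every line parallel to the `i`-th axis, in at most
`k` points, if the `k`-th derivative of `f` in this direction does not vanish there. -/
theorem card_zeros_le_of_coordDeriv_ne_zero (hB : Convex ℝ B)
    (hf : ∀ x ∈ B, ContDiffAt ℝ (⊤ : ℕ∞) f x) {i : Fin (m + 1)}
    (hk : ∀ x ∈ B, coordDeriv f i k x ≠ 0) (y : Euc m) (s : Finset (Euc (m + 1)))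
    (hs : ∀ x ∈ s, (x ∈ B ∧ f x = 0) ∧ dropCoord i x = y) : s.card ≤ k := by
  classical
  rcases s.eq_empty_or_nonempty with rfl | ⟨x₀, hx₀⟩
  · simp
  set e : Euc (m + 1) := EuclideanSpace.single i 1
  set L : ℝ →ᵃ[ℝ] Euc (m + 1) := AffineMap.lineMap (x₀ - x₀ i • e) (x₀ - x₀ i • e + e)
  have hL : ∀ t, L t = t • e + (x₀ - x₀ i • e) := fun t => by
    simp [L, AffineMap.lineMap_apply]
  have hLx : ∀ x ∈ s, L (x i) = x := by
    intro x hx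
    rw [hL]
    ext j
    rcases eq_or_ne j i with rfl | hj
    · simp [e]
    · obtain ⟨l, rfl⟩ := Fin.exists_succAbove_eq hj
      have h : dropCoord i x₀ l = dropCoord i x l := by rw [(hs x₀ hx₀).2, (hs x hx).2]
      simpa [e] using h
  have hinj : InjOn (fun x : Euc (m + 1) => x i) s := by
    intro x hx x' hx' h
    rw [← hLx x hx, ← hLx x' hx']
    exact congrArg L h
  rw [← Finset.card_image_of_injOn hinj]
  refine card_zeros_le_of_deriv_ne_zero (hB.affine_preimage L).ordConnected
    (fun j t => coordDeriv f i j (L t)) (fun j _ t ht => ?_) (fun t ht => hk _ ht) _ fun t ht => ?_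
  · have h1 := (hasStrictFDerivAt_coordDeriv (hf _ ht) i j).hasFDerivAt
    have h2 : HasDerivAt L e t := by
      have := ((hasDerivAt_id t).smul_const e).add_const (x₀ - x₀ i • e)
      rw [one_smul] at this
      exact this.congr_of_eventuallyEq (.of_forall hL)
    have := h1.comp_hasDerivAt t h2
    rwa [fderiv_coordDeriv_single (hf _ ht)] at this
  · obtain ⟨x, hx, rfl⟩ := Finset.mem_image.1 ht
    simp only [mem_preimage, hLx x hx, coordDeriv_zero]
    exact (hs x hx).1

theorem exists_partition_zeros_hausdorffMeasure_le (hB : IsOpen B)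
    (hf : ∀ x ∈ B, ContDiffAt ℝ (⊤ : ℕ∞) f x)
    (hk : ∀ x ∈ B, coordDeriv f 0 k x ≠ 0) {C : ℝ≥0} (hC : 1 < C) :
    ∃ E : Fin k × ℕ → Set (Euc (m + 1)), Pairwise (Function.onFun Disjoint E) ∧
      ⋃ l, E l = {x ∈ B | f x = 0} ∧ (∀ l i, MeasurableSet (dropCoord i '' E l)) ∧
      ∀ l, μH[(m : ℝ)] (E l) ≤ C * (C * ∑ i, μH[(m : ℝ)] (dropCoord i '' E l)) := by
  have hcont : ∀ j, ContinuousOn (coordDeriv f 0 j) B := fun j x hx =>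
    (contDiffAt_coordDeriv (hf x hx) 0 j).continuousAt.continuousWithinAt
  set S : ℕ → Set (Euc (m + 1)) := fun j =>
    {x ∈ B | (fun l : Fin (j + 1) => coordDeriv f 0 l x) = 0} ∩
      (B ∩ coordDeriv f 0 (j + 1) ⁻¹' {0}ᶜ)
  have hSl : ∀ j, IsLocallyClosed (S j) := fun j =>
    (hB.isLocallyClosed_setOf_eq
      (g := fun x => fun l : Fin (j + 1) => coordDeriv f 0 l x)
      (continuousOn_pi.2 fun l => hcont l) 0).inter ((hcont (j + 1)).isOpen_inter_preimage hB isOpen_compl_singleton).isLocallyClosed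
  have hS0 : ∀ j, ∀ x ∈ S j, ∀ l ≤ j, coordDeriv f 0 l x = 0 := fun j x hx l hl =>
    congrFun hx.1.2 ⟨l, Nat.lt_succ_of_le hl⟩
  have hSd : Pairwise (Function.onFun Disjoint S) := by
    rw [pairwise_disjoint_on]
    exact fun i j hij => disjoint_left.2 fun x hi hj => hi.2.2 (hS0 j x hj _ hij)
  have hSU : ⋃ j : Fin k, S j = {x ∈ B | f x = 0} := by
    ext x
    simp only [mem_iUnion, mem_ofPred_eq]
    constructor
    · rintro ⟨j, hj⟩
      exact ⟨hj.1.1, by rw [← coordDeriv_zero (f := f) 0 x]; exact hS0 _ x hj 0 (Nat.zero_le _)⟩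
    · rintro ⟨hx, hfx⟩
      classical
      have hex : ∃ j, coordDeriv f 0 j x ≠ 0 := ⟨k, hk x hx⟩
      obtain ⟨j, hj⟩ : ∃ j, Nat.find hex = j + 1 :=
        Nat.exists_eq_succ_of_ne_zero fun h =>
          Nat.find_spec hex (by rw [h, coordDeriv_zero, hfx])
      have hjk : j + 1 ≤ k := hj ▸ Nat.find_min' hex (hk x hx)
      refine ⟨⟨j, hjk⟩, ⟨hx, ?_⟩, hx, ?_⟩
      · funext l
        by_contra h
        have := Nat.find_min' hex h
        have := l.2
        simp only at this
        omega
      · have := Nat.find_spec hex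
        rw [hj] at this
        exact this
  have hex := fun j : Fin k => exists_partition_hausdorffMeasure_le (hSl j)
    (F := coordDeriv f 0 j) (fun p hp => ⟨_, hasStrictFDerivAt_coordDeriv (hf p hp.1.1) 0 j,
      fun h => hp.2.2 (by
        have := fderiv_coordDeriv_single (hf p hp.1.1) 0 j
        rw [h] at this
        exact this.symm)⟩)
    (fun x hx => hS0 j x hx j le_rfl) hC
  choose E hEd hEU hEm hEle using hex
  have hES : ∀ j l, E j l ⊆ S j := fun j l => hEU j ▸ subset_iUnion (E j) l
  refine ⟨fun p => E p.1 p.2, ?_, ?_, fun p => hEm p.1 p.2, fun p => hEle p.1 p.2⟩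
  · rintro ⟨j, l⟩ ⟨j', l'⟩ hne
    rcases eq_or_ne j j' with rfl | hj
    · exact hEd j fun h => hne (congrArg (Prod.mk j) h)
    · exact (hSd fun h => hj (Fin.ext h)).mono (hES j l) (hES j' l')
  · rw [iUnion_prod', ← hSU]
    exact iUnion_congr hEU

theorem hausdorffMeasure_zeros_inter_ball_le {r : ℝ} (hr : 0 < r)
    (hf : ∀ x ∈ ball 0 r, ContDiffAt ℝ (⊤ : ℕ∞) f x)
    (hk : ∀ x ∈ ball 0 r, ∀ i, coordDeriv f i k x ≠ 0) :
    μH[(m : ℝ)] {x ∈ ball 0 r | f x = 0} ≤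
      (m + 1) * (k * (2 ^ m * ENNReal.ofReal (r ^ m))) := by
  have key : ∀ C : ℝ≥0, 1 < C → μH[(m : ℝ)] {x ∈ ball 0 r | f x = 0} ≤
      C * (C * ((m + 1) * (k * (2 ^ m * ENNReal.ofReal (r ^ m))))) := by
    intro C hC
    obtain ⟨E, hEd, hEU, hEm, hEle⟩ :=
      exists_partition_zeros_hausdorffMeasure_le isOpen_ball hf (fun x hx => hk x hx 0) hC
    have hEx : ∀ x, (∃ l, x ∈ E l) ↔ x ∈ ball 0 r ∧ f x = 0 := fun x => by
      rw [← mem_iUnion, hEU, mem_ofPred_eq]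
    calc μH[(m : ℝ)] {x ∈ ball 0 r | f x = 0} ≤ ∑' l, μH[(m : ℝ)] (E l) := by
          rw [← hEU]
          exact measure_iUnion_le E
      _ ≤ ∑' l, C * (C * ∑ i, μH[(m : ℝ)] (dropCoord i '' E l)) := ENNReal.tsum_le_tsum hEle
      _ = C * (C * ∑ i, ∑' l, μH[(m : ℝ)] (dropCoord i '' E l)) := by
          rw [ENNReal.tsum_mul_left, ENNReal.tsum_mul_left,
            Summable.tsum_finsetSum fun _ _ => ENNReal.summable]
      _ ≤ C * (C * ∑ _i : Fin (m + 1), k * (2 ^ m * ENNReal.ofReal (r ^ m))) := by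
          gcongr with i
          refine (tsum_measure_image_le _ _ hEd (fun l => hEm l i)
            (isOpen_ball (x := (0 : Euc m)) (ε := r)).measurableSet (fun l x hx => ?_)
            fun y s hs => card_zeros_le_of_coordDeriv_ne_zero (convex_ball 0 r) hf
              (fun x hx => hk x hx i) y s fun x hx => ?_).trans ?_
          · have := ((hEx x).1 ⟨l, hx⟩).1
            rw [mem_ball_zero_iff] at this ⊢
            exact (norm_dropCoord_le i x).trans_lt this
          · rw [← hEx]
            exact hs x hx
          · gcongr
            exact hausdorffMeasure_ball_le m 0 hr
      _ = _ := by simp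
  generalize ha' : ((m + 1) * (k * (2 ^ m * ENNReal.ofReal (r ^ m))) : ℝ≥0∞) = a at key ⊢
  have ha : a ≠ ∞ := by rw [← ha']; finiteness
  clear ha'
  have hlim : Tendsto (fun C : ℝ≥0 => (C : ℝ≥0∞) * (C * a)) (𝓝[>] 1) (𝓝 a) := by
    lift a to ℝ≥0 using ha
    have : Continuous fun C : ℝ≥0 => C * (C * a) := by fun_prop
    have := (this.tendsto 1).mono_left (nhdsWithin_le_nhds (s := Ioi 1))
    rw [one_mul, one_mul] at this
    exact_mod_cast ENNReal.tendsto_coe.2 this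
  exact ge_of_tendsto hlim (eventually_mem_nhdsWithin.mono fun C hC => key C hC)

end DirectionalDerivatives

theorem LinearIsometryEquiv.iteratedFDeriv_comp_apply {E G F : Type*} [NormedAddCommGroup E]
    [NormedSpace ℝ E] [NormedAddCommGroup G] [NormedSpace ℝ G] [NormedAddCommGroup F]
    [NormedSpace ℝ F] (e : G ≃ₗᵢ[ℝ] E) (f : E → F) (x : G) (j : ℕ) (v : Fin j → G) :
    iteratedFDeriv ℝ j (f ∘ e) x v = iteratedFDeriv ℝ j f (e x) fun l => e (v l) := by
  have h := e.toContinuousLinearEquiv.iteratedFDerivWithin_comp_right f uniqueDiffOn_univ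
    (mem_univ (e x)) j
  rw [preimage_univ, iteratedFDerivWithin_univ, iteratedFDerivWithin_univ] at h
  exact congrArg (fun M => M v) h

theorem exists_forall_hausdorffMeasure_zeros_inter_ball_le {m k : ℕ} {U : Set (Euc (m + 1))}
    (hU : IsOpen U) (h0 : 0 ∈ U) {f : Euc (m + 1) → ℝ} (hf : ContDiffOn ℝ (⊤ : ℕ∞) f U)
    (hk : iteratedFDeriv ℝ k f 0 ≠ 0) :
    ∀ᶠ r in 𝓝[>] (0 : ℝ), μH[(m : ℝ)] ({x ∈ U | f x = 0} ∩ ball 0 r) ≤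
      (m + 1) * (k * (2 ^ m * ENNReal.ofReal (r ^ m))) := by
  obtain ⟨w, hw⟩ := hf.exists_iteratedFDeriv_diag_ne_zero hU h0 hk
  obtain ⟨b, hb⟩ := exists_orthonormalBasis_diag_ne_zero _ (Nat.le_add_left 1 m) hw
  set e := b.repr.symm
  set g := f ∘ e
  have hg : ∀ x, e x ∈ U → ContDiffAt ℝ (⊤ : ℕ∞) g x := fun x hx =>
    (hf.contDiffAt (hU.mem_nhds hx)).comp x e.contDiff.contDiffAt
  have hU' : ∀ᶠ x in 𝓝 0, e x ∈ U :=
    e.continuous.continuousAt.eventually_mem (hU.mem_nhds (by simpa using h0))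
  have hk' : ∀ᶠ x in 𝓝 0, ∀ i, coordDeriv g i k x ≠ 0 := by
    rw [eventually_all]
    intro i
    refine (contDiffAt_coordDeriv (hg 0 (by simpa using h0)) i k).continuousAt.eventually_ne ?_
    rw [coordDeriv, e.iteratedFDeriv_comp_apply, map_zero]
    simpa [e] using hb i
  obtain ⟨r₀, hr₀, hball⟩ := Metric.eventually_nhds_iff_ball.1 (hU'.and hk')
  filter_upwards [Ioo_mem_nhdsGT hr₀] with r hr
  have hsub : ball (0 : Euc (m + 1)) r ⊆ ball 0 r₀ := ball_subset_ball hr.2.le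
  have h := hausdorffMeasure_zeros_inter_ball_le hr.1
    (fun x hx => hg x (hball x (hsub hx)).1) (fun x hx => (hball x (hsub hx)).2)
  refine le_trans ?_ h
  rw [← e.toIsometryEquiv.hausdorffMeasure_image _ {x ∈ ball 0 r | g x = 0}]
  refine measure_mono ?_
  rintro x ⟨⟨-, hx⟩, hxr⟩
  refine ⟨e.symm x, ⟨?_, ?_⟩, e.apply_symm_apply x⟩
  · simpa using hxr
  · simpa [g] using hx

/-- If a smooth function `f` on an open neighborhood `U ⊆ ℝⁿ` of `0`
vanishes at `0` to order exactly `k ≥ 1`, then the `(n−1)`-dimensional upper Hausdorff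
density of the zero set `N(f)` at `0` is at most `(n · 2^{n−1}/α(n−1)) · k`. -/
theorem upper_hausdorff_density_bound_scalar
    (n : ℕ) (hn : 1 ≤ n)
    (U : Set (Euc n)) (hUopen : IsOpen U) (h0U : (0 : Euc n) ∈ U)
    (f : Euc n → ℝ) (hf : ContDiffOn ℝ (⊤ : ℕ∞) f U)
    (k : ℕ) (hk : 1 ≤ k)
    (hvan : ∀ m < k, iteratedFDeriv ℝ m f 0 = 0)
    (hord : iteratedFDeriv ℝ k f 0 ≠ 0) :
    upperHausdorffDensity (n - 1) {x ∈ U | f x = 0} 0 ≤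
      (n : ℝ≥0∞) * 2 ^ (n - 1) * k / unitBallVol (n - 1) := by
  obtain ⟨m, rfl⟩ := Nat.exists_eq_add_of_le' hn
  rw [Nat.add_sub_cancel]
  refine limsup_le_of_le (h := ?_)
  filter_upwards [exists_forall_hausdorffMeasure_zeros_inter_ball_le hUopen h0U hf hord,
    self_mem_nhdsWithin] with r hr hr0
  have hr0' : ENNReal.ofReal (r ^ m) ≠ 0 := by
    simpa using pow_pos (mem_Ioi.1 hr0) m
  calc μH[(m : ℝ)] ({x ∈ U | f x = 0} ∩ ball 0 r) / (unitBallVol m * ENNReal.ofReal (r ^ m))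
      ≤ ((m + 1) * (k * (2 ^ m * ENNReal.ofReal (r ^ m)))) /
          (unitBallVol m * ENNReal.ofReal (r ^ m)) := by gcongr
    _ = (((m + 1 : ℕ) : ℝ≥0∞) * 2 ^ m * k * ENNReal.ofReal (r ^ m)) /
          (unitBallVol m * ENNReal.ofReal (r ^ m)) := by
        congr 1
        push_cast
        ring
    _ = ((m + 1 : ℕ) : ℝ≥0∞) * 2 ^ m * k / unitBallVol m :=
        ENNReal.mul_div_mul_right _ _ hr0' ENNReal.ofReal_ne_top
end
end
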